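/- Let a₀, b, c₁, c₂ ∈ ℝ and define F(r) = −a₀r + 2b·ln r + c₁/r + c₂ for r > 0. Let r > 0 be a point with F(r) > 0, and define λ(r) = −ln F(r) on a neighbourhood where F > 0. Then λ satisfies the equation −λ''(r) + λ'(r)² − (2/r)λ'(r) + (2e^{λ(r)}/r²)(a₀r − b) = 0. -/

import Mathlib

open Filter Topology in
/-- If `F > 0` solves `F'' + (2/r)F' + (2/r²)(a r - b) = 0` at `r`, then `-log F` solves
the corresponding quasilinear equation. -/
theorem neg_log_solves {F G : ℝ → ℝ} {r F'' a b : ℝ}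
    (hF : ∀ᶠ x in 𝓝 r, HasDerivAt F (G x) x) (hG : HasDerivAt G F'' r) (hFr : 0 < F r)
    (h : F'' + 2 / r * G r + 2 / r ^ 2 * (a * r - b) = 0) :
    -(deriv (deriv fun x => -Real.log (F x)) r) + (deriv (fun x => -Real.log (F x)) r) ^ 2
      - (2 / r) * deriv (fun x => -Real.log (F x)) r
      + (2 * Real.exp (-Real.log (F r)) / r ^ 2) * (a * r - b) = 0 := by
  have hFr' : HasDerivAt F (G r) r := hF.self_of_nhds
  have hd : deriv (fun x => -Real.log (F x)) =ᶠ[𝓝 r] fun x => -(G x / F x) := by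
    filter_upwards [hF, hFr'.continuousAt.eventually (lt_mem_nhds hFr)] with x hx hpos
    exact (hx.log (ne_of_gt hpos)).neg.deriv
  have hdd : deriv (deriv fun x => -Real.log (F x)) r
      = -((F'' * F r - G r * G r) / F r ^ 2) := by
    rw [hd.deriv_eq]
    exact (hG.div hFr' hFr.ne').neg.deriv
  rw [hdd, hd.self_of_nhds, Real.exp_neg, Real.exp_log hFr]
  have hne := hFr.ne'
  calc _ = (F'' + 2 / r * G r + 2 / r ^ 2 * (a * r - b)) / F r := by
        field_simp
        ring
    _ = 0 := by rw [h, zero_div]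

/-- `λ = -ln(-a₀r + 2b ln r + c₁/r + c₂)` solves the equatorial-plane field equation
`-λ'' + λ'² - (2/r)λ' + (2e^λ/r²)(a₀r - b) = 0` wherever `F > 0`. -/
theorem stmt_11 (a₀ b c₁ c₂ : ℝ) (r : ℝ) (hr : 0 < r)
    (F lam : ℝ → ℝ)
    (hF : F = fun r => -a₀ * r + 2 * b * Real.log r + c₁ / r + c₂)
    (hFr : 0 < F r)
    (hlam : lam = fun r => -Real.log (F r)) :
    -(deriv (deriv lam) r) + (deriv lam r) ^ 2 - (2 / r) * deriv lam r
      + (2 * Real.exp (lam r) / r ^ 2) * (a₀ * r - b) = 0 := by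
  subst hF hlam
  have hderiv : ∀ x : ℝ, x ≠ 0 →
      HasDerivAt (fun r => -a₀ * r + 2 * b * Real.log r + c₁ / r + c₂)
        (-a₀ + 2 * b * x⁻¹ - c₁ / x ^ 2) x := by
    intro x hx
    refine (((((hasDerivAt_id x).const_mul (-a₀)).add
      ((Real.hasDerivAt_log hx).const_mul (2 * b))).add
      ((hasDerivAt_const x c₁).div (hasDerivAt_id x) hx)).add_const c₂).congr_deriv ?_
    simp only [id]
    ring
  have hderiv₂ : HasDerivAt (fun x => -a₀ + 2 * b * x⁻¹ - c₁ / x ^ 2)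
      (-(2 * b) / r ^ 2 + 2 * c₁ / r ^ 3) r := by
    refine ((((hasDerivAt_inv hr.ne').const_mul (2 * b)).const_add (-a₀)).sub
      ((hasDerivAt_const r c₁).div (hasDerivAt_pow 2 r) (pow_ne_zero 2 hr.ne'))).congr_deriv ?_
    field_simp
    ring
  refine neg_log_solves ((eventually_ne_nhds hr.ne').mono hderiv) hderiv₂ hFr ?_
  field_simp
  ring
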